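/- Suppose λ* is attained at some X* ∈ S, i.e. min_{1≤i≤N} f_i(X*)/(c_i g_i(X*)) = λ* and min_{1≤i≤N} f_i(X)/(c_i g_i(X)) ≤ λ* for every X ∈ S. Suppose also that { min_{1≤i≤N} (f_i(X) − λ* c_i g_i(X)) : X ∈ S } is bounded above. Then F(λ*) = 0, and the supremum defining F(λ*) is attained at X*. -/

import Mathlib

/-- The minimum of a finite family of reals indexed by `Fin N`, `N > 0`. -/
noncomputable def minOver {N : ℕ} (hN : 0 < N) (v : Fin N → ℝ) : ℝ :=
  Finset.univ.inf' (Finset.univ_nonempty_iff.mpr (Fin.pos_iff_nonempty.mp hN)) v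

theorem le_minOver_iff {N : ℕ} (hN : 0 < N) {v : Fin N → ℝ} {a : ℝ} :
    a ≤ minOver hN v ↔ ∀ i, a ≤ v i := by
  simp [minOver]

theorem minOver_le_iff {N : ℕ} (hN : 0 < N) {v : Fin N → ℝ} {a : ℝ} :
    minOver hN v ≤ a ↔ ∃ i, v i ≤ a := by
  simp [minOver]

/-- If the optimal max-min value `λ*` is attained at `X*`, then the parametric Dinkelbach
value satisfies `F(λ*) = 0`, and the supremum defining `F(λ*)` is attained at `X*`. -/
theorem stmt10 {S : Type*} [Nonempty S] {N : ℕ} (hN : 0 < N)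
    (f g : Fin N → S → ℝ) (hg : ∀ i X, 0 < g i X)
    (c : Fin N → ℝ) (hc : ∀ i, 0 < c i)
    (lamstar : ℝ)
    (hstar : lamstar = sSup (Set.range fun X : S => minOver hN fun i => f i X / (c i * g i X)))
    (Xs : S)
    (hXsval : minOver hN (fun i => f i Xs / (c i * g i Xs)) = lamstar)
    (hXsmax : ∀ X : S, minOver hN (fun i => f i X / (c i * g i X)) ≤ lamstar)
    (hbdd : BddAbove (Set.range fun X : S =>
      minOver hN fun i => f i X - lamstar * c i * g i X)) :
    sSup (Set.range fun X : S => minOver hN fun i => f i X - lamstar * c i * g i X) = 0 ∧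
      ∀ X : S, minOver hN (fun i => f i X - lamstar * c i * g i X) ≤
        minOver hN (fun i => f i Xs - lamstar * c i * g i Xs) := by
  have hpos (i X) : 0 < c i * g i X := mul_pos (hc i) (hg i X)
  have hle (X : S) : minOver hN (fun i => f i X - lamstar * c i * g i X) ≤ 0 := by
    obtain ⟨i, hi⟩ := (minOver_le_iff hN).mp (hXsmax X)
    refine (minOver_le_iff hN).mpr ⟨i, ?_⟩
    linarith [(div_le_iff₀ (hpos i X)).mp hi]
  have hge : 0 ≤ minOver hN (fun i => f i Xs - lamstar * c i * g i Xs) := by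
    refine (le_minOver_iff hN).mpr fun i => ?_
    linarith [(le_div_iff₀ (hpos i Xs)).mp ((le_minOver_iff hN).mp hXsval.ge i)]
  refine ⟨IsGreatest.csSup_eq ⟨⟨Xs, (hle Xs).antisymm hge⟩, ?_⟩, fun X => (hle X).trans hge⟩
  rintro _ ⟨X, rfl⟩
  exact hle X
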